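/- Let A₀ = [b_{i−j}]_{i,j≥0} be the Toeplitz matrix and A = [√((min(i,j)+1)/(max(i,j)+1))·b_{i−j}]_{i,j≥0} on ℓ²(ℤ₊), where b are the Fourier coefficients of a symbol φ ∈ W^{1,2}(𝕋). Then A − A₀ is a Hilbert–Schmidt operator with ‖A − A₀‖²_{S₂} ≤ (π²/24)·‖φ'‖²_{L²(𝕋)}. -/

import Mathlib

open MeasureTheory intervalIntegral Real

local notation "ℓ²" => lp (fun _ : ℕ => ℂ) 2

/-- Fubini on a triangle: moving the primitive from one factor of an integral to the other. -/
theorem integral_primitive_mul_eq_integral_mul_primitive {a b : ℝ} (hab : a ≤ b) {f g : ℝ → ℂ}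
    (hf : IntervalIntegrable f volume a b) (hg : IntervalIntegrable g volume a b) :
    ∫ x in a..b, (∫ t in a..x, f t) * g x = ∫ t in a..b, f t * ∫ x in t..b, g x := by
  rw [intervalIntegrable_iff_integrableOn_Ioc_of_le hab] at hf hg
  have hind : Integrable ({p : ℝ × ℝ | p.2 ≤ p.1}.indicator fun p => g p.1 * f p.2)
      ((volume.restrict (Set.Ioc a b)).prod (volume.restrict (Set.Ioc a b))) :=
    (hg.mul_prod hf).indicator (measurableSet_le measurable_snd measurable_fst)
  have hswap := integral_integral_swap (f := fun x t =>
    {p : ℝ × ℝ | p.2 ≤ p.1}.indicator (fun p => g p.1 * f p.2) (x, t)) hind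
  rw [integral_of_le hab, integral_of_le hab]
  convert hswap using 1
  · refine setIntegral_congr_fun measurableSet_Ioc fun x hx => ?_
    have : ∀ t, {p : ℝ × ℝ | p.2 ≤ p.1}.indicator (fun p => g p.1 * f p.2) (x, t) =
        (Set.Iic x).indicator (fun t => g x * f t) t := fun t => by
      simp [Set.indicator_apply]
    simp only [this]
    rw [MeasureTheory.integral_indicator measurableSet_Iic, Measure.restrict_restrict measurableSet_Iic,
      Set.inter_comm, Set.Ioc_inter_Iic, min_eq_right hx.2, MeasureTheory.integral_const_mul,
      integral_of_le hx.1.le, mul_comm]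
  · refine setIntegral_congr_fun measurableSet_Ioc fun t ht => ?_
    have : ∀ x, {p : ℝ × ℝ | p.2 ≤ p.1}.indicator (fun p => g p.1 * f p.2) (x, t) =
        (Set.Ici t).indicator (fun x => g x * f t) x := fun x => by
      simp [Set.indicator_apply]
    have hset : Set.Ici t ∩ Set.Ioc a b = Set.Icc t b := by
      ext x
      simp only [Set.mem_inter_iff, Set.mem_Ici, Set.mem_Ioc, Set.mem_Icc]
      exact ⟨fun h => ⟨h.1, h.2.2⟩, fun h => ⟨h.1, ht.1.trans_le h.1, h.2⟩⟩
    simp only [this]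
    rw [MeasureTheory.integral_indicator measurableSet_Ici, Measure.restrict_restrict measurableSet_Ici,
      hset, integral_Icc_eq_integral_Ioc, MeasureTheory.integral_mul_const, integral_of_le ht.2, mul_comm]

theorem integral_exp_neg_int_mul_I {l : ℤ} (hl : l ≠ 0) (t : ℝ) :
    ∫ x in t..(2 * π), Complex.exp (-(l : ℂ) * x * Complex.I) =
      (Complex.exp (-(l : ℂ) * t * Complex.I) - 1) / (l * Complex.I) := by
  have hc : -(l : ℂ) * Complex.I ≠ 0 := by simp [hl]
  have hexp : Complex.exp (-(l : ℂ) * Complex.I * (2 * π : ℝ)) = 1 :=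
    Complex.exp_eq_one_iff.2 ⟨-l, by push_cast; ring⟩
  have hcomm : ∀ x : ℝ, -(l : ℂ) * x * Complex.I = -(l : ℂ) * Complex.I * x := fun x => by ring
  simp only [hcomm]
  rw [integral_exp_mul_complex hc, hexp]
  have : (l : ℂ) ≠ 0 := by exact_mod_cast hl
  field_simp
  ring

/-- Differentiation multiplies the `l`-th Fourier coefficient of an absolutely continuous
periodic function by `l * I`. -/
theorem integral_deriv_mul_exp_eq {φ φ' : ℝ → ℂ} (hper : φ (2 * π) = φ 0)
    (hint : IntervalIntegrable φ' volume 0 (2 * π))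
    (hAC : ∀ x : ℝ, φ x = φ 0 + ∫ t in (0 : ℝ)..x, φ' t) (l : ℤ) :
    ∫ x in (0 : ℝ)..(2 * π), φ' x * Complex.exp (-(l : ℂ) * x * Complex.I) =
      l * Complex.I *
        ∫ x in (0 : ℝ)..(2 * π), φ x * Complex.exp (-(l : ℂ) * x * Complex.I) := by
  have hzero : ∫ x in (0 : ℝ)..(2 * π), φ' x = 0 := by
    have := hAC (2 * π)
    rw [hper] at this
    exact left_eq_add.1 this
  rcases eq_or_ne l 0 with rfl | hl
  · simpa using hzero
  have hcont : Continuous fun x : ℝ => Complex.exp (-(l : ℂ) * x * Complex.I) := by fun_prop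
  have hprim : IntervalIntegrable (fun x => (∫ t in (0 : ℝ)..x, φ' t) *
      Complex.exp (-(l : ℂ) * x * Complex.I)) volume 0 (2 * π) :=
    ((continuousOn_primitive_interval' hint Set.left_mem_uIcc).mul
      hcont.continuousOn).intervalIntegrable
  have hsplit : ∀ x : ℝ, φ x * Complex.exp (-(l : ℂ) * x * Complex.I) =
      φ 0 * Complex.exp (-(l : ℂ) * x * Complex.I) +
        (∫ t in (0 : ℝ)..x, φ' t) * Complex.exp (-(l : ℂ) * x * Complex.I) := fun x => by
    rw [hAC x]; ring
  have hl' : (l : ℂ) ≠ 0 := by exact_mod_cast hl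
  simp only [hsplit]
  rw [intervalIntegral.integral_add ((hcont.intervalIntegrable _ _).const_mul _) hprim, intervalIntegral.integral_const_mul,
    integral_exp_neg_int_mul_I hl, integral_primitive_mul_eq_integral_mul_primitive (by positivity)
      hint (hcont.intervalIntegrable _ _)]
  simp only [integral_exp_neg_int_mul_I hl, ← mul_div_assoc, intervalIntegral.integral_div, mul_sub,
    mul_one]
  rw [intervalIntegral.integral_sub (hint.mul_continuousOn hcont.continuousOn) hint, hzero]
  have hexp : Complex.exp (-(l : ℂ) * (0 : ℝ) * Complex.I) = 1 := by simp
  rw [hexp, mul_one, sub_self, zero_div, zero_add, sub_zero,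
    mul_div_cancel₀ _ (mul_ne_zero hl' Complex.I_ne_zero)]

/-- Parseval's identity for functions that are square integrable over a period `2 * π`. -/
theorem hasSum_sq_norm_integral_mul_exp {f : ℝ → ℂ} (hmeas : Measurable f)
    (hL2 : IntervalIntegrable (fun x => ‖f x‖ ^ 2) volume 0 (2 * π)) :
    HasSum (fun l : ℤ => ‖(1 / (2 * π) : ℂ) *
        ∫ x in (0 : ℝ)..(2 * π), f x * Complex.exp (-(l : ℂ) * x * Complex.I)‖ ^ 2)
      ((1 / (2 * π)) * ∫ x in (0 : ℝ)..(2 * π), ‖f x‖ ^ 2) := by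
  have hmem : MemLp f 2 (volume.restrict (Set.Ioc 0 (2 * π))) :=
    (memLp_two_iff_integrable_sq_norm hmeas.aestronglyMeasurable).2
      ((intervalIntegrable_iff_integrableOn_Ioc_of_le two_pi_pos.le).1 hL2)
  convert hasSum_sq_fourierCoeffOn two_pi_pos hmem using 1
  · funext l
    rw [fourierCoeffOn_eq_integral, Complex.real_smul]
    congr 3
    · simp
    · refine integral_congr fun x _ => ?_
      simp only [fourier_coe_apply, smul_eq_mul]
      rw [mul_comm]
      congr 2
      have : (π : ℂ) ≠ 0 := by exact_mod_cast pi_ne_zero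
      push_cast
      field_simp
      ring
  · simp

theorem sq_sqrt_div_sub_one_le {m M : ℝ} (hm : 0 < m) (hmM : m ≤ M) :
    (√(m / M) - 1) ^ 2 ≤ (M - m) ^ 2 * (1 / 4 * (1 / m ^ 2)) := by
  have hM : 0 < M := hm.trans_le hmM
  set s := √(m / M) with hs
  have hs0 : 0 < s := by positivity
  have hs2 : s ^ 2 = m / M := sq_sqrt (by positivity)
  have hs1 : s ≤ 1 := sqrt_le_one.2 ((div_le_one hM).2 hmM)
  have hmeq : m = s ^ 2 * M := by rw [hs2]; field_simp
  rw [hmeq, show (M - s ^ 2 * M) ^ 2 * (1 / 4 * (1 / (s ^ 2 * M) ^ 2)) =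
    ((1 - s ^ 2) / (2 * s ^ 2)) ^ 2 by field_simp; ring, ← neg_sq]
  refine pow_le_pow_left₀ (by linarith) ?_ 2
  rw [le_div_iff₀ (by positivity)]
  nlinarith [mul_nonneg (sub_nonneg.2 hs1) hs0.le, mul_nonneg (sub_nonneg.2 hs1) (sub_nonneg.2 hs1),
    mul_nonneg (mul_nonneg (sub_nonneg.2 hs1) hs0.le) (sub_nonneg.2 hs1)]

theorem hasSum_one_div_four_mul_succ_sq :
    HasSum (fun k : ℕ => 1 / 4 * (1 / ((k : ℝ) + 1) ^ 2)) (π ^ 2 / 24) := by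
  have h := ((hasSum_nat_add_iff' (f := fun n : ℕ => 1 / (n : ℝ) ^ 2) 1).2
    hasSum_zeta_two).mul_left (1 / 4)
  have hval : 1 / 4 * (π ^ 2 / 6 - ∑ i ∈ Finset.range 1, 1 / (i : ℝ) ^ 2) = π ^ 2 / 24 := by
    norm_num
    ring
  rw [hval] at h
  exact_mod_cast h

theorem injective_sub_min : Function.Injective fun p : ℕ × ℕ => ((p.1 : ℤ) - p.2, min p.1 p.2) := by
  rintro ⟨i, j⟩ ⟨i', j'⟩ h
  simp only [Prod.mk.injEq] at h ⊢
  omega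

/-- If the entries of a nonnegative matrix are dominated by a function of the diagonal times a
function of the position on it, then so is their sum. -/
theorem summable_and_tsum_le_mul_of_le_sub_mul_min {t : ℕ × ℕ → ℝ} {f : ℤ → ℝ} {w : ℕ → ℝ}
    {a c : ℝ} (ht : ∀ p, 0 ≤ t p) (hf : ∀ l, 0 ≤ f l) (hw : ∀ k, 0 ≤ w k) (hfa : HasSum f a)
    (hwc : HasSum w c) (hle : ∀ p : ℕ × ℕ, t p ≤ f ((p.1 : ℤ) - p.2) * w (min p.1 p.2)) :
    Summable t ∧ ∑' p, t p ≤ c * a := by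
  have hprod : HasSum (fun q : ℤ × ℕ => f q.1 * w q.2) (a * c) :=
    hfa.mul hwc (hfa.summable.mul_of_nonneg hwc.summable hf hw)
  have hbd := hprod.summable.comp_injective injective_sub_min
  have hsum : Summable t := hbd.of_nonneg_of_le ht hle
  refine ⟨hsum, (hsum.tsum_le_tsum hle hbd).trans ?_⟩
  rw [mul_comm, ← hprod.tsum_eq]
  exact tsum_comp_le_tsum_of_inj hprod.summable (fun q => mul_nonneg (hf q.1) (hw q.2))
    injective_sub_min

theorem bergman_minus_hardy_hilbert_schmidt
    (φ φ' : ℝ → ℂ) (b : ℤ → ℂ)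
    (hper : Function.Periodic φ (2 * π))
    (hmeas : Measurable φ')
    (hL2 : IntervalIntegrable (fun x => ‖φ' x‖ ^ 2) volume 0 (2 * π))
    (hAC : ∀ x : ℝ, φ x = φ 0 + ∫ t in (0 : ℝ)..x, φ' t)
    (hb : ∀ l : ℤ, b l =
      (1 / (2 * π) : ℂ) * ∫ x in (0 : ℝ)..(2 * π), φ x * Complex.exp (-(l : ℂ) * x * Complex.I))
    (A A₀ : ℓ² →L[ℂ] ℓ²)
    (hA₀ : ∀ i j : ℕ, @inner ℂ _ _ (lp.single 2 i (1 : ℂ)) (A₀ (lp.single 2 j 1)) =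
      b ((i : ℤ) - j))
    (hA : ∀ i j : ℕ, @inner ℂ _ _ (lp.single 2 i (1 : ℂ)) (A (lp.single 2 j 1)) =
      (Real.sqrt ((min i j + 1 : ℝ) / (max i j + 1)) : ℂ) * b ((i : ℤ) - j)) :
    Summable (fun p : ℕ × ℕ =>
      ‖@inner ℂ _ _ (lp.single 2 p.1 (1 : ℂ)) ((A - A₀) (lp.single 2 p.2 1))‖ ^ 2) ∧
    (∑' p : ℕ × ℕ,
      ‖@inner ℂ _ _ (lp.single 2 p.1 (1 : ℂ)) ((A - A₀) (lp.single 2 p.2 1))‖ ^ 2) ≤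
      Real.pi ^ 2 / 24 * ((1 / (2 * π)) * ∫ x in (0 : ℝ)..(2 * π), ‖φ' x‖ ^ 2) := by
  have hint : IntervalIntegrable φ' volume 0 (2 * π) := by
    rw [intervalIntegrable_iff_integrableOn_Ioc_of_le two_pi_pos.le] at hL2 ⊢
    exact ((memLp_two_iff_integrable_sq_norm hmeas.aestronglyMeasurable).2 hL2).integrable
      one_le_two
  have hper0 : φ (2 * π) = φ 0 := by simpa using hper 0
  have hparseval : HasSum (fun l : ℤ => (l : ℝ) ^ 2 * ‖b l‖ ^ 2)
      ((1 / (2 * π)) * ∫ x in (0 : ℝ)..(2 * π), ‖φ' x‖ ^ 2) := by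
    convert hasSum_sq_norm_integral_mul_exp hmeas hL2 using 2 with l
    rw [integral_deriv_mul_exp_eq hper0 hint hAC, mul_left_comm, ← hb, norm_mul, norm_mul,
      Complex.norm_I, mul_one, mul_pow, Complex.norm_intCast, sq_abs]
  refine summable_and_tsum_le_mul_of_le_sub_mul_min (fun _ => sq_nonneg _)
    (fun _ => by positivity) (fun _ => by positivity) hparseval hasSum_one_div_four_mul_succ_sq ?_
  rintro ⟨i, j⟩
  rw [_root_.sub_apply, inner_sub_right, hA, hA₀, ← sub_one_mul, norm_mul, mul_pow,
    ← Complex.ofReal_one, ← Complex.ofReal_sub, Complex.norm_real, norm_eq_abs, sq_abs]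
  have hbound := sq_sqrt_div_sub_one_le (m := min (i : ℝ) j + 1) (M := max (i : ℝ) j + 1)
    (by positivity) (by gcongr; exact min_le_max)
  have hdiff : (max (i : ℝ) j + 1 - (min (i : ℝ) j + 1)) ^ 2 = ((i : ℝ) - j) ^ 2 := by
    rw [add_sub_add_right_eq_sub, max_sub_min_eq_abs, sq_abs, sub_sq_comm]
  rw [hdiff] at hbound
  push_cast
  rw [mul_right_comm]
  gcongr
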